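/- arXiv:2508.01792 — 2 statements merged into one kernel-verified Lean document; each statement's English description precedes it below -/
import Mathlib

section
/- Let X be at the same time a simplicial complex and an n-PCM with n ≥ 0. Then for every h ∈ X: if h ∈ ΔX, the poset β□_X(h) is an (n − dim(h) − 1)-PCM, and if h ∉ ΔX, the poset β□_X(h) is an (n − dim(h) − 1)-surface. -/
namespace PCMPaper

variable {α : Type*} [PartialOrder α]

/-- The set of elements of `X` strictly below `h` (α□_X(h)). -/
def alphaS (X : Set α) (h : α) : Set α := {x ∈ X | x < h}

/-- The set of elements of `X` strictly above `h` (β□_X(h)). -/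
def betaS (X : Set α) (h : α) : Set α := {x ∈ X | h < x}

/-- The (strict) neighborhood θ□_X(h) = α□_X(h) ∪ β□_X(h). -/
def thetaS (X : Set α) (h : α) : Set α := alphaS X h ∪ betaS X h

/-- The rank of `h` in the poset `X`: the maximal length of a strictly increasing
chain in `X` ending at `h`.  (It equals 0 when α□_X(h) = ∅ and
`max_{x ∈ α□_X(h)} rank X x + 1` otherwise, for finite `X`.) -/
noncomputable def rank (X : Set α) (h : α) : ℕ :=
  sSup {n : ℕ | ∃ c : Fin (n + 1) → α, StrictMono c ∧ (∀ i, c i ∈ X) ∧ c (Fin.last n) = h}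

open scoped Classical in
/-- The rank of the poset `X`: maximal rank of its elements, `-1` if empty. -/
noncomputable def rankSet (X : Set α) : ℤ :=
  if X = ∅ then -1 else ((sSup (rank X '' X) : ℕ) : ℤ)

/-- One step of a path in `X`: two distinct comparable elements of `X`. -/
def rel (X : Set α) (x y : α) : Prop :=
  x ∈ X ∧ y ∈ X ∧ x ≠ y ∧ (x < y ∨ y < x)

/-- `X` is (path-)connected: any two elements are joined by a path in `X`. -/
def IsConnected (X : Set α) : Prop :=
  ∀ x ∈ X, ∀ y ∈ X, Relation.ReflTransGen (rel X) x y

/-- `IsSurfaceAux (k + 1) X` means that `X` is a (discrete) `k`-surface. -/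
def IsSurfaceAux : ℕ → Set α → Prop
  | 0, X => X = ∅
  | 1, X => ∃ x y : α, x ≠ y ∧ ¬ x < y ∧ ¬ y < x ∧ X = {x, y}
  | (n + 2), X => X.Nonempty ∧ IsConnected X ∧ ∀ h ∈ X, IsSurfaceAux (n + 1) (thetaS X h)

/-- `X` is a discrete `k`-surface (`k : ℤ`, `k ≥ -1`). -/
def IsSurface (k : ℤ) (X : Set α) : Prop :=
  ∃ n : ℕ, (n : ℤ) = k + 1 ∧ IsSurfaceAux n X

/-- The border ΔX of a poset `X` of rank `n`:
elements whose neighborhood is not an `(n-1)`-surface. -/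
def border (X : Set α) : Set α :=
  {h ∈ X | ¬ IsSurface (rankSet X - 1) (thetaS X h)}

/-- The interior of `X`. -/
def interior' (X : Set α) : Set α := X \ border X

/-- `IsPCMAux (n + 1) X` means that `X` is an `n`-PCM. -/
def IsPCMAux : ℕ → Set α → Prop
  | 0, X => X = ∅
  | 1, X => ∃ x : α, X = {x}
  | (n + 2), X => rankSet X = ((n : ℤ) + 1) ∧ IsConnected X ∧ border X ≠ ∅ ∧
      ∀ h ∈ X, (h ∈ border X → IsPCMAux (n + 1) (thetaS X h)) ∧
               (h ∉ border X → IsSurfaceAux (n + 1) (thetaS X h))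

/-- `X` is an `k`-PCM (`k : ℤ`, `k ≥ -1`). -/
def IsPCM (k : ℤ) (X : Set α) : Prop :=
  ∃ n : ℕ, (n : ℤ) = k + 1 ∧ IsPCMAux n X

/-- Fuel-indexed coherence. -/
def IsCoherentAux : ℕ → Set α → Prop
  | 0, X => X = ∅
  | (n + 1), X => X = ∅ ∨
      ∀ h ∈ X, rankSet (thetaS X h) = rankSet X - 1 ∧ IsCoherentAux n (thetaS X h)

/-- `X` is a coherent poset. -/
def IsCoherent (X : Set α) : Prop := ∃ n : ℕ, IsCoherentAux n X

/-- `X` is a separated union of `(m-1)`-surfaces: a union of `(m-1)`-surfaces such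
that no element of one of them is comparable to an element of another one. -/
def IsSeparatedUnionOfSurfacesAux (m : ℕ) (X : Set α) : Prop :=
  ∃ P : Set (Set α), P.Nonempty ∧ X = ⋃₀ P ∧ (∀ S ∈ P, IsSurfaceAux m S) ∧
    ∀ S ∈ P, ∀ T ∈ P, S ≠ T → ∀ x ∈ S, ∀ y ∈ T, ¬ x ≤ y ∧ ¬ y ≤ x

/-- `IsSmoothPCMAux (n + 1) X` means that `X` is a smooth `n`-PCM. -/
def IsSmoothPCMAux : ℕ → Set α → Prop
  | 0, X => X = ∅
  | 1, X => ∃ x : α, X = {x}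
  | (n + 2), X => rankSet X = ((n : ℤ) + 1) ∧ IsConnected X ∧ border X ≠ ∅ ∧
      IsSeparatedUnionOfSurfacesAux (n + 1) (border X) ∧
      ∀ h ∈ X, IsSurfaceAux (n + 1) (thetaS X h) ∨ IsSmoothPCMAux (n + 1) (thetaS X h)

/-- `X` is a smooth `k`-PCM (`k : ℤ`, `k ≥ -1`). -/
def IsSmoothPCM (k : ℤ) (X : Set α) : Prop :=
  ∃ n : ℕ, (n : ℤ) = k + 1 ∧ IsSmoothPCMAux n X

/-- A simplicial complex: a finite family of nonempty finite sets, closed under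
taking nonempty subsets and under nonempty intersections. -/
def IsSimplicialComplex {V : Type*} [DecidableEq V] (X : Set (Finset V)) : Prop :=
  X.Finite ∧ (∀ h ∈ X, h.Nonempty) ∧
  (∀ h ∈ X, ∀ h' : Finset V, h'.Nonempty → h' ⊆ h → h' ∈ X) ∧
  (∀ h ∈ X, ∀ h' ∈ X, (h ∩ h').Nonempty → h ∩ h' ∈ X)

/-- The dimension of a simplex. -/
def dim {V : Type*} (h : Finset V) : ℤ := (h.card : ℤ) - 1

/-- The link of a simplex `h` in a family of simplices `S`. -/
def link {V : Type*} [DecidableEq V] (h : Finset V) (S : Set (Finset V)) : Set (Finset V) :=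
  {h' ∈ S | h ∩ h' = ∅ ∧ h ∪ h' ∈ S}

/-- `X` is pure of rank `n`: every simplex is contained in an `n`-dimensional one. -/
def Pure {V : Type*} (X : Set (Finset V)) (n : ℤ) : Prop :=
  ∀ h ∈ X, ∃ g ∈ X, h ⊆ g ∧ dim g = n

/-- Any two `n`-simplices of `X` are joined by a path in `X` all of whose elements
are simplices of dimension `n - 1` or `n` (i.e. `X` is `(n-1)`-connected). -/
def NConnected {V : Type*} (X : Set (Finset V)) (n : ℤ) : Prop :=
  ∀ a ∈ X, dim a = n → ∀ b ∈ X, dim b = n →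
    Relation.ReflTransGen (rel {h | h ∈ X ∧ (dim h = n - 1 ∨ dim h = n)}) a b

/-- `X` is a pseudomanifold of rank `n`. -/
def IsPseudomanifold {V : Type*} [DecidableEq V] (X : Set (Finset V)) (n : ℤ) : Prop :=
  IsSimplicialComplex X ∧ rankSet X = n ∧
  ((n = 0 ∧ ∃ v : V, X = {({v} : Finset V)}) ∨
   (1 ≤ n ∧ Pure X n ∧
    (∀ h ∈ X, dim h = n - 1 →
      Set.ncard {g | g ∈ X ∧ h ⊆ g ∧ dim g = n} ∈ ({1, 2} : Set ℕ)) ∧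
    NConnected X n))

/-- `X` is a normal pseudomanifold of rank `n`: a pseudomanifold such that the link
of every simplex of dimension at most `n - 2` is a pseudomanifold. -/
def IsNormalPseudomanifold {V : Type*} [DecidableEq V] (X : Set (Finset V)) (n : ℤ) : Prop :=
  IsPseudomanifold X n ∧
  ∀ h ∈ X, dim h ≤ n - 2 → IsPseudomanifold (link h X) (n - dim h - 1)

theorem reflTransGen_rel_of_le {X : Set α} {x y : α} (hx : x ∈ X) (hy : y ∈ X)
    (h : x ≤ y ∨ y ≤ x) : Relation.ReflTransGen (rel X) x y := by
  by_cases hxy : x = y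
  · subst hxy
    exact .refl
  · exact .single ⟨hx, hy, hxy,
      h.imp (fun h => lt_of_le_of_ne h hxy) (fun h => lt_of_le_of_ne h (Ne.symm hxy))⟩

theorem thetaS_eq_empty_of_pair {x y z : α} (hxy : ¬ x < y) (hyx : ¬ y < x)
    (hz : z ∈ ({x, y} : Set α)) : thetaS {x, y} z = ∅ := by
  ext w
  simp only [thetaS, alphaS, betaS, Set.mem_union, Set.mem_ofPred_eq, Set.mem_insert_iff,
    Set.mem_singleton_iff, Set.mem_empty_iff_false, iff_false] at *
  rcases hz with rfl | rfl <;> rintro (⟨rfl | rfl, h⟩ | ⟨rfl | rfl, h⟩) <;>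
    first | exact lt_irrefl _ h | contradiction

theorem IsSurfaceAux.nonempty {a : ℕ} {A : Set α} (h : IsSurfaceAux (a + 1) A) :
    A.Nonempty := by
  cases a with
  | zero =>
    obtain ⟨x, y, -, -, -, rfl⟩ := h
    exact ⟨x, by simp⟩
  | succ a => exact h.1

theorem IsSurfaceAux.thetaS {a : ℕ} {A : Set α} (h : IsSurfaceAux (a + 1) A) {x : α}
    (hx : x ∈ A) : IsSurfaceAux a (thetaS A x) := by
  cases a with
  | zero =>
    obtain ⟨y, z, -, hyz, hzy, rfl⟩ := h
    exact thetaS_eq_empty_of_pair hyz hzy hx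
  | succ a => exact h.2.2 x hx

theorem IsPCMAux.thetaS {m : ℕ} {X : Set α} (h : IsPCMAux (m + 1) X) {x : α}
    (hx : x ∈ X) : IsSurfaceAux m (thetaS X x) ∨ IsPCMAux m (thetaS X x) := by
  cases m with
  | zero =>
    obtain ⟨y, rfl⟩ := h
    left
    have := thetaS_eq_empty_of_pair (lt_irrefl y) (lt_irrefl y) (z := x) (by simpa using hx)
    rwa [Set.pair_eq_singleton] at this
  | succ m =>
    by_cases hb : x ∈ border X
    · exact .inr ((h.2.2.2 x hx).1 hb)
    · exact .inl ((h.2.2.2 x hx).2 hb)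

theorem IsPCMAux.not_isSurfaceAux {m : ℕ} {X : Set α} (h : IsPCMAux (m + 1) X) :
    ¬ IsSurfaceAux (m + 1) X := by
  intro hs
  cases m with
  | zero =>
    obtain ⟨z, rfl⟩ := h
    obtain ⟨x, y, hxy, -, -, h⟩ := hs
    have hx : x ∈ ({z} : Set α) := by simp [h]
    have hy : y ∈ ({z} : Set α) := by simp [h]
    exact hxy (hx.trans hy.symm)
  | succ m =>
    obtain ⟨x, hx, hn⟩ := Set.nonempty_iff_ne_empty.mpr h.2.2.1
    exact hn ⟨m + 1, by rw [h.1]; push_cast; ring, hs.thetaS hx⟩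

theorem thetaS_union_of_mem_left {A B : Set α} (hAB : ∀ a ∈ A, ∀ b ∈ B, a < b) {x : α}
    (hx : x ∈ A) : thetaS (A ∪ B) x = thetaS A x ∪ B := by
  ext y
  have h := hAB x hx y
  have h' : y ∈ B → ¬ y < x := fun hy => (h hy).not_gt
  simp only [thetaS, alphaS, betaS, Set.mem_union, Set.mem_ofPred_eq]
  tauto

theorem thetaS_union_of_mem_right {A B : Set α} (hAB : ∀ a ∈ A, ∀ b ∈ B, a < b) {x : α}
    (hx : x ∈ B) : thetaS (A ∪ B) x = A ∪ thetaS B x := by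
  ext y
  have h := fun hy => hAB y hy x hx
  have h' : y ∈ A → ¬ x < y := fun hy => (h hy).not_gt
  simp only [thetaS, alphaS, betaS, Set.mem_union, Set.mem_ofPred_eq]
  tauto

theorem thetaS_subset (A : Set α) (x : α) : thetaS A x ⊆ A := by
  rintro y (hy | hy) <;> exact hy.1

theorem isConnected_union {A B : Set α} (hAB : ∀ a ∈ A, ∀ b ∈ B, a < b)
    (hA : A.Nonempty) (hB : B.Nonempty) : IsConnected (A ∪ B) := by
  obtain ⟨a, ha⟩ := hA
  obtain ⟨b, hb⟩ := hB
  have key : ∀ x ∈ A ∪ B, Relation.ReflTransGen (rel (A ∪ B)) x a ∧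
      Relation.ReflTransGen (rel (A ∪ B)) a x := by
    have hab := (hAB a ha b hb).le
    rintro x (hx | hx)
    · have hxb := (hAB x hx b hb).le
      exact ⟨(reflTransGen_rel_of_le (.inl hx) (.inr hb) (.inl hxb)).trans
          (reflTransGen_rel_of_le (.inr hb) (.inl ha) (.inr hab)),
        (reflTransGen_rel_of_le (.inl ha) (.inr hb) (.inl hab)).trans
          (reflTransGen_rel_of_le (.inr hb) (.inl hx) (.inr hxb))⟩
    · have hax := (hAB a ha x hx).le
      exact ⟨reflTransGen_rel_of_le (.inr hx) (.inl ha) (.inr hax),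
        reflTransGen_rel_of_le (.inl ha) (.inr hx) (.inl hax)⟩
  exact fun x hx y hy => (key x hx).1.trans (key y hy).2

/-- The ordinal sum of two surfaces is a surface. -/
theorem IsSurfaceAux.union {a b : ℕ} {A B : Set α} (hA : IsSurfaceAux a A)
    (hB : IsSurfaceAux b B) (hAB : ∀ a ∈ A, ∀ b ∈ B, a < b) :
    IsSurfaceAux (a + b) (A ∪ B) := by
  induction hm : a + b generalizing a b A B with
  | zero =>
    obtain ⟨rfl, rfl⟩ : a = 0 ∧ b = 0 := by omega
    rw [show A = ∅ from hA, show B = ∅ from hB, Set.union_empty]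
    rfl
  | succ m ih =>
    rcases a with _ | a
    · rw [show A = ∅ from hA, Set.empty_union, ← hm, zero_add]
      exact hB
    rcases b with _ | b
    · rw [show B = ∅ from hB, Set.union_empty, ← hm, add_zero]
      exact hA
    obtain rfl : m = a + b + 1 := by omega
    refine ⟨hA.nonempty.inl, isConnected_union hAB hA.nonempty hB.nonempty, ?_⟩
    rintro x (hx | hx)
    · rw [thetaS_union_of_mem_left hAB hx]
      exact ih (hA.thetaS hx) hB (fun y hy => hAB y (thetaS_subset _ _ hy)) (by omega)
    · rw [thetaS_union_of_mem_right hAB hx]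
      exact ih hA (hB.thetaS hx) (fun y hy z hz => hAB y hy z (thetaS_subset _ _ hz)) (by omega)

/-- A surface may be cancelled from the bottom of an ordinal sum that is a surface. -/
theorem IsSurfaceAux.of_union {a m : ℕ} {A B : Set α} (hA : IsSurfaceAux a A)
    (hAB : ∀ a ∈ A, ∀ b ∈ B, a < b) (h : IsSurfaceAux m (A ∪ B)) :
    ∃ b, m = a + b ∧ IsSurfaceAux b B := by
  induction a generalizing m A with
  | zero =>
    rw [show A = ∅ from hA, Set.empty_union] at h
    exact ⟨m, by omega, h⟩
  | succ a ih =>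
    obtain ⟨x, hx⟩ := hA.nonempty
    cases m with
    | zero =>
      have hx' : x ∈ A ∪ B := .inl hx
      rw [show A ∪ B = ∅ from h] at hx'
      exact hx'.elim
    | succ m =>
      have hθ := h.thetaS (x := x) (.inl hx)
      rw [thetaS_union_of_mem_left hAB hx] at hθ
      obtain ⟨b, rfl, hb⟩ :=
        ih (hA.thetaS hx) (fun y hy => hAB y (thetaS_subset _ _ hy)) hθ
      exact ⟨b, by omega, hb⟩

/-- A surface may be cancelled from the bottom of an ordinal sum that is a PCM. -/
theorem IsPCMAux.of_union {a m : ℕ} {A B : Set α} (hA : IsSurfaceAux a A)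
    (hAB : ∀ a ∈ A, ∀ b ∈ B, a < b) (h : IsPCMAux m (A ∪ B)) :
    ∃ b, m = a + b ∧ IsPCMAux b B := by
  induction a generalizing m A with
  | zero =>
    rw [show A = ∅ from hA, Set.empty_union] at h
    exact ⟨m, by omega, h⟩
  | succ a ih =>
    obtain ⟨x, hx⟩ := hA.nonempty
    cases m with
    | zero =>
      have hx' : x ∈ A ∪ B := .inl hx
      rw [show A ∪ B = ∅ from h] at hx'
      exact hx'.elim
    | succ m =>
      have hθ := h.thetaS (x := x) (.inl hx)
      rw [thetaS_union_of_mem_left hAB hx] at hθ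
      have hlt : ∀ y ∈ PCMPaper.thetaS A x, ∀ b ∈ B, y < b :=
        fun y hy => hAB y (thetaS_subset _ _ hy)
      rcases hθ with hθ | hθ
      · obtain ⟨b, rfl, hb⟩ := (hA.thetaS hx).of_union hlt hθ
        refine (h.not_isSurfaceAux ?_).elim
        have := hA.union hb hAB
        rwa [add_right_comm] at this
      · obtain ⟨b, rfl, hb⟩ := ih (hA.thetaS hx) hlt hθ
        exact ⟨b, by omega, hb⟩

theorem thetaS_Ioo {s t h : α} (ht : t ∈ Set.Ioo s h) :
    thetaS (Set.Ioo s h) t = Set.Ioo s t ∪ Set.Ioo t h := by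
  ext x
  simp only [thetaS, alphaS, betaS, Set.mem_union, Set.mem_ofPred_eq, Set.mem_Ioo]
  exact or_congr ⟨fun hx => ⟨hx.1.1, hx.2⟩, fun hx => ⟨⟨hx.1, hx.2.trans ht.2⟩, hx.2⟩⟩
    ⟨fun hx => ⟨hx.2, hx.1.2⟩, fun hx => ⟨⟨ht.1.trans hx.1, hx.2⟩, hx.1⟩⟩

/-- An open interval of finite sets is a surface. -/
theorem isSurfaceAux_Ioo {V : Type*} [DecidableEq V] {k : ℕ} {s h : Finset V} (hsh : s ⊆ h)
    (hk : h.card = s.card + k + 1) : IsSurfaceAux k (Set.Ioo s h) := by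
  induction k using Nat.strong_induction_on generalizing s h with
  | _ k ih =>
  have mem_insert : ∀ {a : V}, 1 ≤ k → a ∈ h → a ∉ s → insert a s ∈ Set.Ioo s h := by
    intro a hk1 hah has
    refine ⟨Finset.ssubset_insert has, ?_⟩
    refine (Finset.insert_subset hah hsh).lt_of_ne fun he => ?_
    have := Finset.card_insert_of_notMem has
    rw [he] at this
    omega
  rcases k with _ | _ | k
  · refine Set.eq_empty_iff_forall_notMem.mpr fun t ht => ?_
    have h1 := Finset.card_lt_card ht.1
    have h2 := Finset.card_lt_card ht.2
    omega
  · have hcard : (h \ s).card = 2 := by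
      rw [Finset.card_sdiff_of_subset hsh]
      omega
    obtain ⟨a, b, hab, hd⟩ := Finset.card_eq_two.mp hcard
    have ha : a ∈ h \ s := by simp [hd]
    have hb : b ∈ h \ s := by simp [hd]
    rw [Finset.mem_sdiff] at ha hb
    have hca := Finset.card_insert_of_notMem ha.2
    have hcb := Finset.card_insert_of_notMem hb.2
    refine ⟨insert a s, insert b s, fun he => ?_, fun hlt => ?_, fun hlt => ?_, ?_⟩
    · have : a ∈ insert b s := he ▸ Finset.mem_insert_self a s
      simp [hab, ha.2] at this
    · have := Finset.card_lt_card hlt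
      omega
    · have := Finset.card_lt_card hlt
      omega
    · ext t
      constructor
      · intro ht
        obtain ⟨x, hxt, hxs⟩ := Finset.exists_of_ssubset ht.1
        have h1 := Finset.card_lt_card ht.1
        have h2 := Finset.card_lt_card ht.2
        have hcx := Finset.card_insert_of_notMem hxs
        have he : insert x s = t :=
          Finset.eq_of_subset_of_card_le (Finset.insert_subset hxt ht.1.subset) (by omega)
        have hx : x ∈ h \ s := Finset.mem_sdiff.mpr ⟨ht.2.subset hxt, hxs⟩
        simp only [hd, Finset.mem_insert, Finset.mem_singleton] at hx
        rcases hx with rfl | rfl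
        · exact .inl he.symm
        · exact .inr he.symm
      · rintro (rfl | rfl)
        · exact mem_insert le_rfl ha.1 ha.2
        · exact mem_insert le_rfl hb.1 hb.2
  · have hssub : s ⊂ h := hsh.ssubset_of_ne (by rintro rfl; omega)
    refine ⟨?_, ?_, ?_⟩
    · obtain ⟨a, ha, has⟩ := Finset.exists_of_ssubset hssub
      exact ⟨_, mem_insert (by omega) ha has⟩
    · intro x hx y hy
      obtain ⟨a, hax, has⟩ := Finset.exists_of_ssubset hx.1
      obtain ⟨b, hby, hbs⟩ := Finset.exists_of_ssubset hy.1
      have hah := hx.2.subset hax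
      have hbh := hy.2.subset hby
      have hma := mem_insert (by omega) hah has
      have hmb := mem_insert (by omega) hbh hbs
      have hmab : insert a (insert b s) ∈ Set.Ioo s h := by
        refine ⟨hmb.1.trans_le (Finset.subset_insert _ _), ?_⟩
        refine (Finset.insert_subset hah hmb.2.subset).lt_of_ne fun he => ?_
        have h1 := Finset.card_insert_le a (insert b s)
        have h2 := Finset.card_insert_le b s
        rw [he] at h1
        omega
      refine (reflTransGen_rel_of_le hx hma
        (.inr (Finset.insert_subset hax hx.1.subset))).trans ?_
      refine (reflTransGen_rel_of_le hma hmab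
        (.inl (Finset.insert_subset_insert a (Finset.subset_insert b s)))).trans ?_
      refine (reflTransGen_rel_of_le hmab hmb (.inr (Finset.subset_insert _ _))).trans ?_
      exact reflTransGen_rel_of_le hmb hy (.inl (Finset.insert_subset hby hy.1.subset))
    · intro t ht
      rw [thetaS_Ioo ht]
      have h1 := Finset.card_lt_card ht.1
      have h2 := Finset.card_lt_card ht.2
      obtain ⟨i, hi⟩ : ∃ i, t.card = s.card + i + 1 := ⟨t.card - s.card - 1, by omega⟩
      obtain ⟨j, hj⟩ : ∃ j, h.card = t.card + j + 1 := ⟨h.card - t.card - 1, by omega⟩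
      rw [show k + 1 = i + j by omega]
      exact (ih i (by omega) ht.1.subset hi).union (ih j (by omega) ht.2.subset hj)
        fun x hx y hy => hx.2.trans hy.1

theorem rankSet_singleton (x : α) : rankSet ({x} : Set α) = 0 := by
  have hr : rank ({x} : Set α) x = 0 := by
    refine Nat.le_zero.mp (csSup_le' ?_)
    rintro n ⟨c, hc, hmem, -⟩
    by_contra hn
    have : (0 : Fin (n + 1)) = Fin.last n :=
      hc.injective ((hmem 0).trans (hmem (Fin.last n)).symm)
    exact hn (by simpa using (congrArg Fin.val this).symm.le)
  simp [rankSet, hr]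

/-- If `X` is at the same time a simplicial complex and an `n`-PCM with
`n ≥ 0`, then for every `h ∈ X`: if `h ∈ ΔX` then `β□_X(h)` is an
`(n - dim h - 1)`-PCM, and if `h ∉ ΔX` then `β□_X(h)` is an
`(n - dim h - 1)`-surface. -/
theorem statement_12 {V : Type*} [DecidableEq V] (X : Set (Finset V)) (n : ℤ) (hn : 0 ≤ n)
    (hsc : IsSimplicialComplex X) (hpcm : IsPCM n X) :
    ∀ h ∈ X, (h ∈ border X → IsPCM (n - dim h - 1) (betaS X h)) ∧
             (h ∉ border X → IsSurface (n - dim h - 1) (betaS X h)) := by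
  intro h hh
  obtain ⟨-, hne, hsub, -⟩ := hsc
  obtain ⟨N, hN, hP⟩ := hpcm
  obtain ⟨a, ha⟩ : ∃ a, h.card = a + 1 :=
    Nat.exists_eq_add_one_of_ne_zero (Finset.card_pos.mpr (hne h hh)).ne'
  have hα : IsSurfaceAux a (alphaS X h) := by
    have : alphaS X h = Set.Ioo ∅ h := by
      ext t
      exact ⟨fun ht => ⟨Finset.empty_ssubset.mpr (hne t ht.1), ht.2⟩,
        fun ht => ⟨hsub h hh t (Finset.empty_ssubset.mp ht.1) ht.2.subset, ht.2⟩⟩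
    rw [this]
    exact isSurfaceAux_Ioo (Finset.empty_subset h) (by simpa using ha)
  have hlt : ∀ s ∈ alphaS X h, ∀ t ∈ betaS X h, s < t := fun s hs t ht => hs.2.trans ht.2
  have hdim : dim h = a := by simp [dim, ha]
  obtain ⟨m, rfl⟩ : ∃ m, N = m + 1 := ⟨N - 1, by omega⟩
  have hrank : rankSet X = m := by
    cases m with
    | zero =>
      obtain ⟨x, rfl⟩ := hP
      exact rankSet_singleton x
    | succ m => simpa using hP.1
  have hsurf : h ∉ border X → IsSurfaceAux m (thetaS X h) := by
    intro hb
    by_contra hs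
    refine hb ⟨hh, ?_⟩
    rintro ⟨k, hk, hk'⟩
    obtain rfl : k = m := by omega
    exact hs hk'
  have hborder : h ∈ border X → IsPCMAux m (thetaS X h) := fun hb =>
    (hP.thetaS hh).resolve_left fun hs => hb.2 ⟨m, by omega, hs⟩
  refine ⟨fun hb => ?_, fun hb => ?_⟩
  · obtain ⟨b, hb, hB⟩ := IsPCMAux.of_union hα hlt (hborder hb)
    exact ⟨b, by omega, hB⟩
  · obtain ⟨b, hb, hB⟩ := IsSurfaceAux.of_union hα hlt (hsurf hb)
    exact ⟨b, by omega, hB⟩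

end PCMPaper
end

section
/- Let X be a simplicial complex of rank n ≥ 1 which is either an n-PCM or an n-surface. Then X is (n−1)-connected: any two n-simplices of X are joined by a path in X all of whose elements are simplices of dimension n−1 or n. Moreover, for any h ∈ X with dim(h) ∈ {1, …, n−2}, any two n-simplices of X strictly containing h are joined by a path contained in β□_X(h) all of whose elements are simplices of dimension n−1 or n. -/
namespace PCMPaper

variable {α : Type*} [PartialOrder α]

/-- `X` is an `(m - 1)`-surface or an `(m - 1)`-PCM. -/
def IsSurfaceOrPCM (m : ℕ) (X : Set α) : Prop :=
  IsSurfaceAux m X ∨ IsPCMAux m X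

lemma IsSurfaceOrPCM.nonempty {m : ℕ} {X : Set α} (h : IsSurfaceOrPCM (m + 1) X) :
    X.Nonempty := by
  rcases m with _ | m
  · rcases h with ⟨x, y, -, -, -, rfl⟩ | ⟨x, rfl⟩
    · exact ⟨x, by simp⟩
    · exact ⟨x, rfl⟩
  · rcases h with h | h
    · exact h.1
    · obtain ⟨x, hx⟩ := Set.nonempty_iff_ne_empty.2 h.2.2.1
      exact ⟨x, hx.1⟩

lemma IsSurfaceOrPCM.isConnected {m : ℕ} {X : Set α} (h : IsSurfaceOrPCM (m + 2) X) :
    IsConnected X := by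
  rcases h with h | h
  · exact h.2.1
  · exact h.2.1

lemma IsSurfaceOrPCM.exists_thetaS {m : ℕ} {X : Set α} (hX : IsSurfaceOrPCM m X) {h : α}
    (hh : h ∈ X) : ∃ k, m = k + 1 ∧ IsSurfaceOrPCM k (thetaS X h) := by
  rcases m with _ | _ | m
  · rcases hX with rfl | rfl <;> exact hh.elim
  · refine ⟨0, rfl, Or.inl (Set.eq_empty_iff_forall_notMem.2 fun z hz => ?_)⟩
    rcases hX with ⟨x, y, -, hxy, hyx, rfl⟩ | ⟨x, rfl⟩
    · rcases hh with rfl | rfl <;> rcases hz with ⟨rfl | rfl, hz⟩ | ⟨rfl | rfl, hz⟩ <;>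
        first
        | exact lt_irrefl _ hz
        | contradiction
    · obtain rfl := Set.mem_singleton_iff.1 hh
      rcases hz with ⟨rfl, hz⟩ | ⟨rfl, hz⟩ <;> exact lt_irrefl _ hz
  · refine ⟨m + 1, rfl, ?_⟩
    rcases hX with hX | hX
    · exact Or.inl (hX.2.2 h hh)
    · by_cases hb : h ∈ border X
      · exact Or.inr ((hX.2.2.2 h hh).1 hb)
      · exact Or.inl ((hX.2.2.2 h hh).2 hb)

lemma rel_mono {S T : Set α} (hST : S ⊆ T) {a b : α} (h : rel S a b) : rel T a b :=
  ⟨hST h.1, hST h.2.1, h.2.2⟩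

lemma alphaS_eq_empty_of_card_eq_one {V : Type*} {X : Set (Finset V)}
    (hne : ∀ h ∈ X, h.Nonempty) {h : Finset V} (hc : h.card = 1) : alphaS X h = ∅ := by
  refine Set.eq_empty_iff_forall_notMem.2 fun g hg => ?_
  have := Finset.card_lt_card hg.2
  have := (hne g hg.1).card_pos
  omega

lemma thetaS_betaS_eq_betaS {V : Type*} {X : Set (Finset V)} {f h : Finset V} (hfh : f < h)
    (hc : h.card = f.card + 1) : thetaS (betaS X f) h = betaS X h := by
  ext g
  constructor
  · rintro (⟨⟨-, hfg⟩, hgh⟩ | ⟨⟨hg, -⟩, hhg⟩)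
    · have := Finset.card_lt_card hfg
      have := Finset.card_lt_card hgh
      omega
    · exact ⟨hg, hhg⟩
  · rintro ⟨hg, hhg⟩
    exact Or.inr ⟨⟨hg, hfh.trans hhg⟩, hhg⟩

/-- In a simplicial complex that is a surface or a PCM, so is the set of strict cofaces of any
simplex. -/
lemma IsSurfaceOrPCM.exists_betaS {V : Type*} [DecidableEq V] {X : Set (Finset V)} {N : ℕ}
    (hX : IsSurfaceOrPCM N X) (hsc : IsSimplicialComplex X) {h : Finset V} (hh : h ∈ X) :
    ∃ k, N = h.card + k ∧ IsSurfaceOrPCM k (betaS X h) := by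
  induction hc : h.card generalizing h with
  | zero => exact absurd hc (hsc.2.1 h hh).card_pos.ne'
  | succ c ih =>
    rcases c.eq_zero_or_pos with rfl | hpos
    · obtain ⟨k, hk, hQ⟩ := hX.exists_thetaS hh
      rw [thetaS, alphaS_eq_empty_of_card_eq_one hsc.2.1 hc, Set.empty_union] at hQ
      exact ⟨k, by omega, hQ⟩
    · obtain ⟨f, hfh, hfc⟩ := Finset.exists_subset_card_eq (s := h) (n := c) (by omega)
      have hlt : f < h := Finset.ssubset_iff_subset_ne.2 ⟨hfh, by rintro rfl; omega⟩
      have hf : f ∈ X := hsc.2.2.1 h hh f (Finset.card_pos.1 (by omega)) hfh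
      obtain ⟨k, hk, hQ⟩ := ih hf hfc
      obtain ⟨k', hk', hQ'⟩ := hQ.exists_thetaS (h := h) ⟨hh, hlt⟩
      rw [thetaS_betaS_eq_betaS hlt (by omega)] at hQ'
      exact ⟨k', by omega, hQ'⟩

/-- A simplicial complex that is a surface or a PCM is pure. -/
lemma IsSurfaceOrPCM.exists_subset_card_eq {V : Type*} [DecidableEq V] {X : Set (Finset V)} {N : ℕ}
    (hX : IsSurfaceOrPCM N X) (hsc : IsSimplicialComplex X) {h : Finset V} (hh : h ∈ X) :
    ∃ g ∈ X, h ⊆ g ∧ g.card = N := by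
  induction hc : N - h.card using Nat.strong_induction_on generalizing h with
  | _ c ih =>
    obtain ⟨_ | k, hk, hQ⟩ := hX.exists_betaS hsc hh
    · exact ⟨h, hh, subset_rfl, by omega⟩
    · obtain ⟨g, hg, hhg⟩ := hQ.nonempty
      have := Finset.card_lt_card hhg
      obtain ⟨g', hg', hgg', hc'⟩ := ih (N - g.card) (by omega) hg rfl
      exact ⟨g', hg', hhg.1.trans hgg', hc'⟩

/-- The simplices of `S` with `N - 1` or `N` vertices. -/
def topSimplices {V : Type*} (S : Set (Finset V)) (N : ℕ) : Set (Finset V) :=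
  {g | g ∈ S ∧ (g.card + 1 = N ∨ g.card = N)}

lemma topSimplices_mono {V : Type*} {S T : Set (Finset V)} (hST : S ⊆ T) (N : ℕ) :
    topSimplices S N ⊆ topSimplices T N :=
  fun _ hg => ⟨hST hg.1, hg.2⟩

/-- A connected set of simplices, closed under taking cofaces, is strongly connected as soon as
the cofaces of each of its simplices of codimension at least two are. -/
lemma IsConnected.reflTransGen_topSimplices {V : Type*} {X S : Set (Finset V)} {N : ℕ}
    (hpure : ∀ h ∈ X, ∃ g ∈ X, h ⊆ g ∧ g.card = N) (hSX : S ⊆ X)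
    (hup : ∀ x ∈ S, ∀ y ∈ X, x ⊆ y → y ∈ S) (hconn : IsConnected S)
    (hloc : ∀ x ∈ S, x.card + 2 ≤ N → ∀ a ∈ betaS X x, a.card = N → ∀ b ∈ betaS X x,
      b.card = N → Relation.ReflTransGen (rel (topSimplices (betaS X x) N)) a b)
    {a b : Finset V} (ha : a ∈ S) (hac : a.card = N) (hb : b ∈ S) (hbc : b.card = N) :
    Relation.ReflTransGen (rel (topSimplices S N)) a b := by
  have cofaces : ∀ x ∈ S, ∀ t ∈ X, x ⊆ t → t.card = N → ∀ u ∈ X, x ⊆ u → u.card = N →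
      Relation.ReflTransGen (rel (topSimplices S N)) t u := by
    intro x hx t ht hxt htc u hu hxu huc
    have hle := Finset.card_le_card hxt
    rcases (by omega : x.card = N ∨ x.card + 1 = N ∨ x.card + 2 ≤ N) with hc | hc | hc
    · rw [← Finset.eq_of_subset_of_card_le hxt (by omega),
        ← Finset.eq_of_subset_of_card_le hxu (by omega)]
    · have hnt : x ≠ t := by rintro rfl; omega
      have hnu : x ≠ u := by rintro rfl; omega
      refine .head (b := x) ⟨⟨hup x hx t ht hxt, .inr htc⟩, ⟨hx, .inl hc⟩, hnt.symm,
        .inr (lt_of_le_of_ne hxt hnt)⟩ (.single ⟨⟨hx, .inl hc⟩, ⟨hup x hx u hu hxu, .inr huc⟩,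
        hnu, .inl (lt_of_le_of_ne hxu hnu)⟩)
    · have hnt : x ≠ t := by rintro rfl; omega
      have hnu : x ≠ u := by rintro rfl; omega
      exact Relation.ReflTransGen.mono (fun _ _ => rel_mono
          (topSimplices_mono (fun y hy => hup x hx y hy.1 hy.2.1) N)) _ _
        (hloc x hx hc t ⟨ht, lt_of_le_of_ne hxt hnt⟩ htc u ⟨hu, lt_of_le_of_ne hxu hnu⟩ huc)
  have path : ∀ y, Relation.ReflTransGen (rel S) a y → ∀ u ∈ X, y ⊆ u → u.card = N →
      Relation.ReflTransGen (rel (topSimplices S N)) a u := by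
    intro y hy
    induction hy with
    | refl => exact cofaces a ha a (hSX ha) subset_rfl hac
    | tail _ hyz ih =>
      intro u hu hzu huc
      obtain ⟨hyS, hzS, -, hlt | hlt⟩ := hyz
      · exact ih u hu (hlt.1.trans hzu) huc
      · obtain ⟨w, hw, hyw, hwc⟩ := hpure _ (hSX hyS)
        exact (ih w hw hyw hwc).trans (cofaces _ hzS w hw (hlt.1.trans hyw) hwc u hu hzu huc)
  exact path b (hconn a ha b hb) b (hSX hb) subset_rfl hbc

lemma IsSurfaceOrPCM.reflTransGen_betaS {V : Type*} [DecidableEq V] {X : Set (Finset V)} {N : ℕ}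
    (hX : IsSurfaceOrPCM N X) (hsc : IsSimplicialComplex X) {h : Finset V} (hh : h ∈ X)
    (hc : h.card + 2 ≤ N) {a b : Finset V} (ha : a ∈ betaS X h) (hac : a.card = N)
    (hb : b ∈ betaS X h) (hbc : b.card = N) :
    Relation.ReflTransGen (rel (topSimplices (betaS X h) N)) a b := by
  induction hk : N - h.card using Nat.strong_induction_on generalizing h a b with
  | _ c ih =>
    obtain ⟨k, hkN, hQ⟩ := hX.exists_betaS hsc hh
    obtain ⟨k, rfl⟩ := Nat.exists_eq_add_of_le' (by omega : 2 ≤ k)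
    refine hQ.isConnected.reflTransGen_topSimplices (fun g hg => hX.exists_subset_card_eq hsc hg)
      (Set.sep_subset X _) (fun x hx y hy hxy => And.intro hy (lt_of_lt_of_le hx.2 hxy))
      (fun x hx hxc s hs hsN t ht htN => ?_) ha hac hb hbc
    have := Finset.card_lt_card hx.2
    exact ih (N - x.card) (by omega) hx.1 hxc hs hsN ht htN rfl

lemma IsSurfaceOrPCM.reflTransGen {V : Type*} [DecidableEq V] {X : Set (Finset V)} {N : ℕ}
    (hN : 2 ≤ N) (hX : IsSurfaceOrPCM N X) (hsc : IsSimplicialComplex X) {a b : Finset V}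
    (ha : a ∈ X) (hac : a.card = N) (hb : b ∈ X) (hbc : b.card = N) :
    Relation.ReflTransGen (rel (topSimplices X N)) a b := by
  obtain ⟨k, rfl⟩ := Nat.exists_eq_add_of_le' hN
  exact hX.isConnected.reflTransGen_topSimplices (fun g hg => hX.exists_subset_card_eq hsc hg)
    subset_rfl (fun _ _ y hy _ => hy)
    (fun x hx hxc s hs hsN t ht htN => hX.reflTransGen_betaS hsc hx hxc hs hsN ht htN)
    ha hac hb hbc

lemma setOf_dim_eq_topSimplices {V : Type*} (S : Set (Finset V)) {n : ℤ} {N : ℕ}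
    (hN : (N : ℤ) = n + 1) :
    {g | g ∈ S ∧ (dim g = n - 1 ∨ dim g = n)} = topSimplices S N := by
  ext g
  simp only [topSimplices, dim, Set.mem_ofPred_eq]
  refine and_congr_right fun _ => ?_
  omega

/-- Let `X` be a simplicial complex of rank `n ≥ 1` which is an `n`-PCM
or an `n`-surface.  Then `X` is `(n-1)`-connected, and moreover for any `h ∈ X` with
`1 ≤ dim h ≤ n - 2`, any two `n`-simplices strictly containing `h` are joined by a path
contained in `β□_X(h)` all of whose elements have dimension `n - 1` or `n`. -/
theorem statement_14 {V : Type*} [DecidableEq V] (X : Set (Finset V)) (n : ℤ) (hn : 1 ≤ n)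
    (hsc : IsSimplicialComplex X) (hrk : rankSet X = n)
    (hX : IsPCM n X ∨ IsSurface n X) :
    NConnected X n ∧
    ∀ h ∈ X, 1 ≤ dim h → dim h ≤ n - 2 →
      ∀ a ∈ betaS X h, dim a = n → ∀ b ∈ betaS X h, dim b = n →
        Relation.ReflTransGen
          (rel {g | g ∈ betaS X h ∧ (dim g = n - 1 ∨ dim g = n)}) a b := by
  obtain ⟨N, hN, hQ⟩ : ∃ N : ℕ, (N : ℤ) = n + 1 ∧ IsSurfaceOrPCM N X := by
    rcases hX with ⟨N, hN, h⟩ | ⟨N, hN, h⟩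
    · exact ⟨N, hN, .inr h⟩
    · exact ⟨N, hN, .inl h⟩
  refine ⟨fun a ha hac b hb hbc => ?_, fun h hh _ hd a ha hac b hb hbc => ?_⟩
  · rw [setOf_dim_eq_topSimplices X hN]
    unfold dim at hac hbc
    exact hQ.reflTransGen (by omega) hsc ha (by omega) hb (by omega)
  · rw [setOf_dim_eq_topSimplices _ hN]
    unfold dim at hac hbc hd
    exact hQ.reflTransGen_betaS hsc hh (by omega) ha (by omega) hb (by omega)

end PCMPaper
end
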